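/- arXiv:2108.00263 — 2 statements merged into one kernel-verified Lean document; each statement's English description precedes it below -/
import Mathlib

section
/- Let V : ℝ^d → ℝ be strictly convex and twice continuously differentiable with ∫ e^{-V(x)} dx = 1 and ‖V''‖_{L_∞} ≤ M, and let ξ be a random vector with density e^{-V}. Then for every u ∈ ℝ^d, the random variable ⟨V'(ξ), u⟩ is subgaussian with ‖⟨V'(ξ), u⟩‖_{ψ_2} ≤ C·√M·‖u‖ for an absolute constant C; in fact E⟨V'(ξ), u⟩^{2k} ≤ (2k−1)!!·M^k·‖u‖^{2k} for every integer k ≥ 1. -/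
open MeasureTheory Real
open scoped RealInnerProductSpace BigOperators ENNReal NNReal

noncomputable section

abbrev Euc (d : ℕ) : Type := EuclideanSpace ℝ (Fin d)

/-- The noise distribution with density `e^{-V(x)}` w.r.t. Lebesgue measure. -/
def noiseMeasure {d : ℕ} (V : Euc d → ℝ) : Measure (Euc d) :=
  MeasureTheory.volume.withDensity fun x => ENNReal.ofReal (Real.exp (-(V x)))

/-- The joint distribution of an i.i.d. sample `X_1, …, X_n` from `P_θ(dx) = e^{-V(x-θ)}dx`. -/
def sampleMeasure {d : ℕ} (V : Euc d → ℝ) (n : ℕ) (θ : Euc d) : Measure (Fin n → Euc d) :=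
  Measure.pi fun _ => (noiseMeasure V).map (fun x => θ + x)

/-- `ψ_α`-norm of a random variable: `sup_{p ≥ 1} p^{-1/α} (E|η|^p)^{1/p}`. -/
def psiNorm {Ω : Type*} [MeasurableSpace Ω] (α : ℝ) (μ : Measure Ω) (η : Ω → ℝ) : ℝ :=
  ⨆ p : {p : ℝ // 1 ≤ p}, (p : ℝ) ^ (-(1 / α)) * (∫ ω, |η ω| ^ (p : ℝ) ∂μ) ^ ((1 : ℝ) / (p : ℝ))

/-- `f` belongs to the Hölder ball of radius `B` in `C^s`, `s = l + ρ`. -/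
def holderCLe {d : ℕ} (l : ℕ) (ρ : ℝ) (f : Euc d → ℝ) (B : ℝ) : Prop :=
  ContDiff ℝ l f ∧
  (∀ j : ℕ, j ≤ l → ∀ x, ‖iteratedFDeriv ℝ j f x‖ ≤ B) ∧
  (∀ x y, ‖iteratedFDeriv ℝ l f x - iteratedFDeriv ℝ l f y‖ ≤ B * ‖x - y‖ ^ ρ)

/-- The operator `(T g)(θ) = E_θ g(θ̂)`. -/
def Texp {d : ℕ} (V : Euc d → ℝ) (n : ℕ) (hatθ : (Fin n → Euc d) → Euc d) (g : Euc d → ℝ) :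
    Euc d → ℝ :=
  fun θ => ∫ x, g (hatθ x) ∂ sampleMeasure V n θ

/-- The operator `𝓑 = 𝓣 - Id`. -/
def Bop {d : ℕ} (V : Euc d → ℝ) (n : ℕ) (hatθ : (Fin n → Euc d) → Euc d) :
    (Euc d → ℝ) → Euc d → ℝ :=
  fun g θ => Texp V n hatθ g θ - g θ

/-- The bias-corrected functional `f_k = Σ_{j=0}^k (-1)^j 𝓑^j f`. -/
def biasCorrect {d : ℕ} (V : Euc d → ℝ) (n : ℕ) (hatθ : (Fin n → Euc d) → Euc d) (k : ℕ)
    (f : Euc d → ℝ) : Euc d → ℝ :=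
  fun θ => ∑ j ∈ Finset.range (k + 1), (-1 : ℝ) ^ j * (Bop V n hatθ)^[j] f θ

/-- The Poincaré constant `c(V)` of the distribution `e^{-V(x)}dx`. -/
def poincareConst {d : ℕ} (V : Euc d → ℝ) : ℝ :=
  sInf {C : ℝ | 0 ≤ C ∧ ∀ g : Euc d → ℝ, LocallyLipschitz g →
    ∫ x, (g x - ∫ y, g y ∂ noiseMeasure V) ^ 2 ∂ noiseMeasure V ≤
      C * ∫ x, ‖gradient g x‖ ^ 2 ∂ noiseMeasure V}


section NoiseMoments

variable {d : ℕ} {V : Euc d → ℝ} {M : ℝ}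

lemma integrable_noiseMeasure_iff (hV : Continuous V) {f : Euc d → ℝ} :
    Integrable f (noiseMeasure V) ↔ Integrable fun x => f x * exp (-(V x)) := by
  have hm : Measurable fun x => ENNReal.ofReal (exp (-(V x))) := by
    have := hV.measurable
    fun_prop
  rw [noiseMeasure, integrable_withDensity_iff hm (by simp)]
  simp [ENNReal.toReal_ofReal (exp_pos _).le]

lemma integral_noiseMeasure (hV : Continuous V) (f : Euc d → ℝ) :
    ∫ x, f x ∂noiseMeasure V = ∫ x, f x * exp (-(V x)) := by
  have hm : Measurable fun x => ENNReal.ofReal (exp (-(V x))) := by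
    have := hV.measurable
    fun_prop
  rw [noiseMeasure, integral_withDensity_eq_integral_toReal_smul hm (by simp)]
  simp [ENNReal.toReal_ofReal (exp_pos _).le, mul_comm]

lemma norm_fderiv_fderiv_le (hM : ∀ x, ‖iteratedFDeriv ℝ 2 V x‖ ≤ M) (x : Euc d) :
    ‖fderiv ℝ (fderiv ℝ V) x‖ ≤ M := by
  rw [← norm_iteratedFDeriv_one, norm_iteratedFDeriv_fderiv]
  exact hM x

lemma norm_fderiv_fderiv_apply_le (hM : ∀ x, ‖fderiv ℝ (fderiv ℝ V) x‖ ≤ M) (x u : Euc d) :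
    ‖fderiv ℝ (fderiv ℝ V) x u u‖ ≤ M * ‖u‖ * ‖u‖ :=
  (ContinuousLinearMap.le_opNorm₂ (fderiv ℝ (fderiv ℝ V) x) u u).trans (by gcongr; exact hM x)

lemma differentiable_fderiv_of_contDiff_two (hV : ContDiff ℝ 2 V) :
    Differentiable ℝ (fderiv ℝ V) :=
  (hV.fderiv_right (m := 1) (by norm_num)).differentiable (by norm_num)

lemma apply_add_le_of_norm_fderiv_fderiv_le (hV : ContDiff ℝ 2 V)
    (hM : ∀ x, ‖fderiv ℝ (fderiv ℝ V) x‖ ≤ M) (x v : Euc d) :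
    V (x + v) ≤ V x + fderiv ℝ V x v + M * ‖v‖ ^ 2 := by
  have hM0 : 0 ≤ M := (fderiv ℝ (fderiv ℝ V) x).opNorm_nonneg.trans (hM x)
  have hlip (y : Euc d) : ‖fderiv ℝ V y - fderiv ℝ V x‖ ≤ M * ‖y - x‖ :=
    Convex.norm_image_sub_le_of_norm_fderiv_le (𝕜 := ℝ) (s := Set.univ)
      (fun z _ => differentiable_fderiv_of_contDiff_two hV z) (fun z _ => hM z) convex_univ
      (Set.mem_univ _) (Set.mem_univ _)
  have hseg (y : Euc d) (hy : y ∈ segment ℝ x (x + v)) :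
      ‖fderiv ℝ V y - fderiv ℝ V x‖ ≤ M * ‖v‖ := by
    refine (hlip y).trans (mul_le_mul_of_nonneg_left ?_ hM0)
    simpa using norm_sub_le_of_mem_segment hy
  have h := Convex.norm_image_sub_le_of_norm_fderiv_le' (𝕜 := ℝ)
    (fun y _ => hV.differentiable (by norm_num) y) hseg (convex_segment x (x + v))
    (left_mem_segment ℝ _ _) (right_mem_segment ℝ _ _)
  rw [add_sub_cancel_left] at h
  have := (le_abs_self _).trans h
  nlinarith

lemma integrable_exp_fderiv (hV : ContDiff ℝ 2 V) (hint : ∫ x, exp (-(V x)) = 1)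
    (hM : ∀ x, ‖fderiv ℝ (fderiv ℝ V) x‖ ≤ M) (v : Euc d) :
    Integrable (fun x => exp (fderiv ℝ V x v)) (noiseMeasure V) := by
  have hI : Integrable fun x => exp (-(V x)) :=
    not_imp_comm.1 integral_undef (by rw [hint]; norm_num)
  rw [integrable_noiseMeasure_iff hV.continuous]
  have hc : Continuous fun x => fderiv ℝ V x v :=
    (hV.continuous_fderiv (by norm_num)).clm_apply continuous_const
  have hVc := hV.continuous
  refine ((hI.comp_add_right (-v)).const_mul (exp (M * ‖v‖ ^ 2))).mono'
    (by fun_prop) (ae_of_all _ fun x => ?_)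
  rw [norm_of_nonneg (by positivity), ← exp_add, ← exp_add, exp_le_exp]
  have := apply_add_le_of_norm_fderiv_fderiv_le hV hM x (-v)
  rw [map_neg, norm_neg] at this
  linarith

lemma integrable_fderiv_pow (hV : ContDiff ℝ 2 V) (hint : ∫ x, exp (-(V x)) = 1)
    (hM : ∀ x, ‖fderiv ℝ (fderiv ℝ V) x‖ ≤ M) (u : Euc d) (n : ℕ) :
    Integrable (fun x => fderiv ℝ V x u ^ n) (noiseMeasure V) := by
  refine ProbabilityTheory.integrable_pow_of_integrable_exp_mul one_ne_zero ?_ ?_ n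
  · simpa using integrable_exp_fderiv hV hint hM u
  · simpa using integrable_exp_fderiv hV hint hM (-u)

/-- Integration by parts against the density `e^{-V}`. -/
lemma integral_fderiv_pow_add_two (hV : ContDiff ℝ 2 V) (hint : ∫ x, exp (-(V x)) = 1)
    (hM : ∀ x, ‖fderiv ℝ (fderiv ℝ V) x‖ ≤ M) (u : Euc d) (n : ℕ) :
    Integrable (fun x => fderiv ℝ V x u ^ n * fderiv ℝ (fderiv ℝ V) x u u) (noiseMeasure V) ∧
    ∫ x, fderiv ℝ V x u ^ (n + 2) ∂noiseMeasure V =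
      (n + 1) * ∫ x, fderiv ℝ V x u ^ n * fderiv ℝ (fderiv ℝ V) x u u ∂noiseMeasure V := by
  have hVc := hV.continuous
  have hc : Continuous fun x => fderiv ℝ (fderiv ℝ V) x u u :=
    (((hV.fderiv_right (m := 1) (by norm_num)).continuous_fderiv (by norm_num)).clm_apply
      continuous_const).clm_apply continuous_const
  have hpow := integrable_fderiv_pow hV hint hM u
  have hprod : Integrable (fun x => fderiv ℝ V x u ^ n * fderiv ℝ (fderiv ℝ V) x u u)
      (noiseMeasure V) :=
    (hpow n).mul_bdd (c := M * ‖u‖ * ‖u‖) hc.aestronglyMeasurable (ae_of_all _ fun x =>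
      norm_fderiv_fderiv_apply_le hM x u)
  have hF (x : Euc d) : HasFDerivAt (fun x => fderiv ℝ V x u ^ (n + 1))
      (((n + 1 : ℕ) * fderiv ℝ V x u ^ n) • (fderiv ℝ (fderiv ℝ V) x).flip u) x := by
    have h := (differentiable_fderiv_of_contDiff_two hV x).hasFDerivAt.clm_apply
      (hasFDerivAt_const u x)
    simpa using h.pow (n + 1)
  have hG (x : Euc d) : HasFDerivAt (fun x => exp (-(V x))) (exp (-(V x)) • -fderiv ℝ V x) x :=
    (hV.differentiable (by norm_num) x).hasFDerivAt.neg.exp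
  have hparts := integral_mul_fderiv_eq_neg_fderiv_mul_of_integrable (μ := volume) (v := u)
    (f := fun x => fderiv ℝ V x u ^ (n + 1)) (g := fun x => exp (-(V x)))
    (by
      have := ((integrable_noiseMeasure_iff hVc).1 hprod).const_mul ((n : ℝ) + 1)
      refine this.congr (ae_of_all _ fun x => ?_)
      simp [(hF x).fderiv]
      ring)
    (by
      have := ((integrable_noiseMeasure_iff hVc).1 (hpow (n + 2))).neg
      refine this.congr (ae_of_all _ fun x => ?_)
      simp [(hG x).fderiv]
      ring)
    ((integrable_noiseMeasure_iff hVc).1 (hpow (n + 1)))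
    (fun x _ => (hF x).differentiableAt) (fun x _ => (hG x).differentiableAt)
  refine ⟨hprod, ?_⟩
  rw [integral_noiseMeasure hVc, integral_noiseMeasure hVc, ← integral_const_mul, ← neg_inj,
    ← integral_neg]
  convert hparts using 1
  · congr with x
    simp [(hG x).fderiv]
    ring
  · congr with x
    simp [(hF x).fderiv]
    ring

lemma integral_fderiv_pow_even_le (hV : ContDiff ℝ 2 V) (hint : ∫ x, exp (-(V x)) = 1)
    (hM : ∀ x, ‖fderiv ℝ (fderiv ℝ V) x‖ ≤ M) (u : Euc d) (k : ℕ) :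
    ∫ x, fderiv ℝ V x u ^ (2 * k) ∂noiseMeasure V ≤
      (Nat.doubleFactorial (2 * k - 1) : ℝ) * M ^ k * ‖u‖ ^ (2 * k) := by
  have hM0 : 0 ≤ M := (fderiv ℝ (fderiv ℝ V) 0).opNorm_nonneg.trans (hM 0)
  induction k with
  | zero => simp [integral_noiseMeasure hV.continuous, hint]
  | succ k ih =>
    obtain ⟨hI, heq⟩ := integral_fderiv_pow_add_two hV hint hM u (2 * k)
    have hmono : ∫ x, fderiv ℝ V x u ^ (2 * k) * fderiv ℝ (fderiv ℝ V) x u u ∂noiseMeasure V ≤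
        ∫ x, fderiv ℝ V x u ^ (2 * k) * (M * ‖u‖ * ‖u‖) ∂noiseMeasure V := by
      refine integral_mono hI ((integrable_fderiv_pow hV hint hM u _).mul_const _) fun x => ?_
      refine mul_le_mul_of_nonneg_left ?_ (by rw [pow_mul]; positivity)
      exact (le_abs_self _).trans (norm_fderiv_fderiv_apply_le hM x u)
    rw [integral_mul_const] at hmono
    have hdf : (Nat.doubleFactorial (2 * (k + 1) - 1) : ℝ) =
        (2 * k + 1) * Nat.doubleFactorial (2 * k - 1) := by
      rw [show 2 * (k + 1) - 1 = 2 * k + 1 by omega, Nat.doubleFactorial_add_one]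
      push_cast
      ring
    calc ∫ x, fderiv ℝ V x u ^ (2 * (k + 1)) ∂noiseMeasure V
        = (2 * k + 1) * ∫ x, fderiv ℝ V x u ^ (2 * k) * fderiv ℝ (fderiv ℝ V) x u u
            ∂noiseMeasure V := by
          rw [mul_add, mul_one, heq]
          push_cast
          ring
      _ ≤ (2 * k + 1) * ((Nat.doubleFactorial (2 * k - 1) * M ^ k * ‖u‖ ^ (2 * k)) *
            (M * ‖u‖ * ‖u‖)) := by
          gcongr
          exact hmono.trans (by gcongr)
      _ = _ := by
          rw [hdf]
          ring

end NoiseMoments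

lemma doubleFactorial_two_mul_sub_one_le_pow (k : ℕ) :
    Nat.doubleFactorial (2 * k - 1) ≤ (2 * k) ^ k := by
  induction k with
  | zero => simp
  | succ k ih =>
    rw [show 2 * (k + 1) - 1 = 2 * k + 1 by omega, Nat.doubleFactorial_add_one, pow_succ']
    refine Nat.mul_le_mul (by omega) (ih.trans ?_)
    gcongr
    omega

/-- Even moments of Gaussian size control the `ψ₂`-norm. -/
lemma psiNorm_two_le_of_even_moments {Ω : Type*} [MeasurableSpace Ω] {μ : Measure Ω}
    [IsProbabilityMeasure μ] {η : Ω → ℝ} {σ : ℝ} (hσ : 0 < σ)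
    (hint : ∀ k : ℕ, Integrable (fun ω => η ω ^ (2 * k)) μ)
    (hη : ∀ k : ℕ, ∫ ω, η ω ^ (2 * k) ∂μ ≤
      (Nat.doubleFactorial (2 * k - 1) : ℝ) * σ ^ (2 * k)) :
    psiNorm 2 μ η ≤ 4 * σ := by
  refine Real.iSup_le (fun ⟨p, hp⟩ => ?_) (by positivity)
  have hp0 : 0 < p := by linarith
  set k := ⌈p / 2⌉₊
  have hk1 : p / 2 ≤ k := Nat.le_ceil _
  have hk2 : (k : ℝ) < p / 2 + 1 := Nat.ceil_lt_add_one (by positivity)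
  have hk0 : (0 : ℝ) < k := by linarith
  set a := √(2 * k) * σ with ha
  have ha0 : 0 < a := by positivity
  have ha2 : a ^ (2 * k) = (2 * k) ^ k * σ ^ (2 * k) := by
    rw [ha, mul_pow, pow_mul, sq_sqrt (by positivity)]
  have hpt (ω : Ω) : |η ω| ^ p ≤ a ^ p * (1 + η ω ^ (2 * k) / a ^ (2 * k)) := by
    have hdiv : |η ω| ^ p = a ^ p * (|η ω| / a) ^ p := by
      rw [← mul_rpow ha0.le (by positivity), mul_div_cancel₀ _ ha0.ne']
    rw [hdiv]
    gcongr
    have heven : η ω ^ (2 * k) / a ^ (2 * k) = (|η ω| / a) ^ (2 * k) := by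
      rw [div_pow, Even.pow_abs (even_two_mul k)]
    rw [heven]
    have hx : 0 ≤ |η ω| / a := by positivity
    rcases le_total (|η ω| / a) 1 with h | h
    · have := rpow_le_one hx h hp0.le
      have : 0 ≤ (|η ω| / a) ^ (2 * k) := by positivity
      linarith
    · have := rpow_le_rpow_of_exponent_le h (show p ≤ ((2 * k : ℕ) : ℝ) by push_cast; linarith)
      rw [rpow_natCast] at this
      linarith
  have hE : ∫ ω, |η ω| ^ p ∂μ ≤ a ^ p * 2 := by
    calc ∫ ω, |η ω| ^ p ∂μ ≤ ∫ ω, a ^ p * (1 + η ω ^ (2 * k) / a ^ (2 * k)) ∂μ :=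
          integral_mono_of_nonneg (ae_of_all _ fun ω => by positivity)
            (((integrable_const 1).add ((hint k).div_const _)).const_mul _) (ae_of_all _ hpt)
      _ = a ^ p * (1 + (∫ ω, η ω ^ (2 * k) ∂μ) / a ^ (2 * k)) := by
          rw [integral_const_mul, integral_add (integrable_const 1) ((hint k).div_const _),
            integral_div]
          simp
      _ ≤ a ^ p * (1 + 1) := by
          gcongr
          rw [div_le_one (by positivity), ha2]
          refine (hη k).trans ?_
          gcongr
          exact_mod_cast doubleFactorial_two_mul_sub_one_le_pow k
      _ = a ^ p * 2 := by norm_num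
  have hroot : (∫ ω, |η ω| ^ p ∂μ) ^ (1 / p) ≤ a * 2 := by
    calc (∫ ω, |η ω| ^ p ∂μ) ^ (1 / p) ≤ (a ^ p * 2) ^ (1 / p) :=
          rpow_le_rpow (integral_nonneg fun ω => by positivity) hE (by positivity)
      _ = a * 2 ^ (1 / p) := by
          rw [mul_rpow (by positivity) (by norm_num), ← rpow_mul ha0.le, mul_one_div_cancel hp0.ne',
            rpow_one]
      _ ≤ a * 2 := by
          gcongr
          exact (rpow_le_rpow_of_exponent_le one_le_two ((div_le_one hp0).2 hp)).trans_eq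
            (rpow_one 2)
  have hsqrt : √(2 * k) ≤ 2 * √p := by
    rw [sqrt_le_left (by positivity), mul_pow, sq_sqrt hp0.le]
    linarith
  have hsp : 0 < √p := sqrt_pos.2 hp0
  calc p ^ (-(1 / 2 : ℝ)) * (∫ ω, |η ω| ^ p ∂μ) ^ (1 / p) ≤ (√p)⁻¹ * (2 * √p * σ * 2) := by
        rw [rpow_neg hp0.le, ← sqrt_eq_rpow]
        gcongr
        exact hroot.trans (by rw [ha]; gcongr)
    _ = 4 * σ := by
        field_simp
        norm_num

/-- Lemma 3.3 / `bd_on_V'`: `⟨V'(ξ), u⟩` is subgaussian with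
`ψ₂`-norm `≲ √M ‖u‖`, and its even moments are bounded by `(2k-1)!! M^k ‖u‖^{2k}`. -/
theorem stmt_10 :
    ∃ C : ℝ, 0 < C ∧
      ∀ (d : ℕ) (V : Euc d → ℝ) (M : ℝ),
        0 < M →
        StrictConvexOn ℝ Set.univ V →
        ContDiff ℝ 2 V →
        (∫ x, Real.exp (-(V x)) = 1) →
        (∀ x, ‖iteratedFDeriv ℝ 2 V x‖ ≤ M) →
        ∀ u : Euc d,
          psiNorm 2 (noiseMeasure V) (fun x => ⟪gradient V x, u⟫) ≤
              C * Real.sqrt M * ‖u‖ ∧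
            ∀ k : ℕ, 1 ≤ k →
              ∫ x, ⟪gradient V x, u⟫ ^ (2 * k) ∂ noiseMeasure V ≤
                (Nat.doubleFactorial (2 * k - 1) : ℝ) * M ^ k * ‖u‖ ^ (2 * k) := by
  refine ⟨4, by norm_num, fun d V M hM0 _ hV hint hM2 u => ?_⟩
  have hM := norm_fderiv_fderiv_le hM2
  simp only [inner_gradient_left]
  have hmom := integral_fderiv_pow_even_le hV hint hM u
  refine ⟨?_, fun k _ => hmom k⟩
  have : IsProbabilityMeasure (noiseMeasure V) := by
    rw [isProbabilityMeasure_iff_real]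
    simpa [hint] using integral_noiseMeasure hV.continuous (fun _ => 1)
  rcases eq_or_ne u 0 with rfl | hu
  · refine Real.iSup_le (fun ⟨p, hp⟩ => ?_) (by simp)
    have hp0 : p ≠ 0 := by linarith
    simp [hp0]
  · have hu0 : 0 < ‖u‖ := norm_pos_iff.2 hu
    rw [mul_assoc]
    refine psiNorm_two_le_of_even_moments (by positivity)
      (fun k => integrable_fderiv_pow hV hint hM u _) fun k => (hmom k).trans_eq ?_
    rw [mul_pow, pow_mul (√M), sq_sqrt hM0.le]
    ring
end
end

section
/- Under Assumption (A), let g_n'(0) = n^{-1} Σ_{j=1}^n V'(ξ_j) where ξ_1, …, ξ_n are i.i.d. with density e^{-V}. Then there is an absolute constant C such that for all t ≥ 1, with probability at least 1 − e^{−t}: ‖g_n'(0)‖ ≤ C·√M·( √(d/n) ∨ √(t/n) ). -/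
open MeasureTheory Real
open scoped RealInnerProductSpace BigOperators ENNReal NNReal

noncomputable section

/-- A `C²` function with Hessian bounded by `M` satisfies the descent inequality. -/
lemma inner_gradient_le_of_norm_iteratedFDeriv_two_le {d : ℕ} {V : Euc d → ℝ} {M : ℝ}
    (hV : ContDiff ℝ 2 V) (hM : ∀ x, ‖iteratedFDeriv ℝ 2 V x‖ ≤ M) (x u : Euc d) :
    ⟪gradient V x, u⟫ ≤ V x - V (x - u) + M * ‖u‖ ^ 2 := by
  have hM0 : 0 ≤ M := (norm_nonneg _).trans (hM x)
  have hd : Differentiable ℝ (fderiv ℝ V) :=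
    (hV.fderiv_right (m := 1) (by norm_num)).differentiable (by norm_num)
  have hlip : ∀ y, ‖fderiv ℝ V y - fderiv ℝ V x‖ ≤ M * ‖y - x‖ := fun y =>
    convex_univ.norm_image_sub_le_of_norm_fderiv_le (fun z _ => hd z)
      (fun z _ => by
        rw [← norm_iteratedFDeriv_one, norm_iteratedFDeriv_fderiv]
        exact hM z) (Set.mem_univ x) (Set.mem_univ y)
  have h := (convex_closedBall x ‖u‖).norm_image_sub_le_of_norm_fderiv_le'
    (f := V) (φ := fderiv ℝ V x) (C := M * ‖u‖) (x := x) (y := x - u) (𝕜 := ℝ)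
    (fun z _ => hV.differentiable (by norm_num) z)
    (fun z hz => (hlip z).trans
      (mul_le_mul_of_nonneg_left (mem_closedBall_iff_norm.mp hz) hM0))
    (by simp) (by simp)
  rw [inner_gradient_left]
  simp only [sub_sub_cancel_left, map_neg, norm_neg, Real.norm_eq_abs] at h
  nlinarith [(abs_le.mp h).2]

lemma continuous_gradient_of_contDiff {d : ℕ} {V : Euc d → ℝ} (hV : ContDiff ℝ 2 V) :
    Continuous (gradient V) :=
  (InnerProductSpace.toDual ℝ (Euc d)).symm.continuous.comp (hV.continuous_fderiv (by norm_num))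

lemma lintegral_exp_neg_eq_one {d : ℕ} {V : Euc d → ℝ} (hint : ∫ x, Real.exp (-(V x)) = 1) :
    ∫⁻ x, ENNReal.ofReal (Real.exp (-(V x))) = 1 := by
  have hi : Integrable (fun x => Real.exp (-(V x))) := by
    by_contra h
    rw [integral_undef h] at hint
    exact zero_ne_one hint
  rw [← ofReal_integral_eq_lintegral_ofReal hi (ae_of_all _ fun x => (Real.exp_pos _).le), hint,
    ENNReal.ofReal_one]

lemma isProbabilityMeasure_noiseMeasure {d : ℕ} {V : Euc d → ℝ}
    (hint : ∫ x, Real.exp (-(V x)) = 1) : IsProbabilityMeasure (noiseMeasure V) :=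
  ⟨by rw [noiseMeasure, withDensity_apply _ MeasurableSet.univ, Measure.restrict_univ,
    lintegral_exp_neg_eq_one hint]⟩

/-- The score `V'(ξ)` is sub-Gaussian: compare `V` with its translate by `u`. -/
lemma lintegral_exp_inner_gradient_le {d : ℕ} {V : Euc d → ℝ} {M : ℝ}
    (hV : ContDiff ℝ 2 V) (hint : ∫ x, Real.exp (-(V x)) = 1)
    (hM : ∀ x, ‖iteratedFDeriv ℝ 2 V x‖ ≤ M) (u : Euc d) :
    ∫⁻ x, ENNReal.ofReal (Real.exp ⟪gradient V x, u⟫) ∂noiseMeasure V ≤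
      ENNReal.ofReal (Real.exp (M * ‖u‖ ^ 2)) := by
  have hVm : Measurable V := hV.continuous.measurable
  have hg := (continuous_gradient_of_contDiff hV).measurable
  rw [noiseMeasure, lintegral_withDensity_eq_lintegral_mul _ (by fun_prop) (by fun_prop)]
  calc _ ≤ ∫⁻ x, ENNReal.ofReal (Real.exp (M * ‖u‖ ^ 2)) *
          ENNReal.ofReal (Real.exp (-(V (x - u)))) := by
        refine lintegral_mono fun x => ?_
        simp only [Pi.mul_apply]
        rw [← ENNReal.ofReal_mul (Real.exp_pos _).le, ← ENNReal.ofReal_mul (Real.exp_pos _).le,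
          ← Real.exp_add, ← Real.exp_add]
        refine ENNReal.ofReal_le_ofReal (Real.exp_le_exp.mpr ?_)
        linarith [inner_gradient_le_of_norm_iteratedFDeriv_two_le hV hM x u]
    _ = _ := by
        rw [lintegral_const_mul _ (by fun_prop),
          lintegral_sub_right_eq_self (fun x => ENNReal.ofReal (Real.exp (-(V x)))) u,
          lintegral_exp_neg_eq_one hint, mul_one]

lemma lintegral_exp_inner_sum_gradient_le {d n : ℕ} {V : Euc d → ℝ} {M : ℝ}
    (hV : ContDiff ℝ 2 V) (hint : ∫ x, Real.exp (-(V x)) = 1)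
    (hM : ∀ x, ‖iteratedFDeriv ℝ 2 V x‖ ≤ M) (u : Euc d) :
    ∫⁻ x, ENNReal.ofReal (Real.exp ⟪∑ j, gradient V (x j), u⟫)
        ∂(Measure.pi fun _ : Fin n => noiseMeasure V) ≤
      ENNReal.ofReal (Real.exp (n * M * ‖u‖ ^ 2)) := by
  have := isProbabilityMeasure_noiseMeasure hint
  have hg := (continuous_gradient_of_contDiff hV).measurable
  have hf : Measurable fun y => ENNReal.ofReal (Real.exp ⟪gradient V y, u⟫) := by fun_prop
  have hprod : ∀ x : Fin n → Euc d, ENNReal.ofReal (Real.exp ⟪∑ j, gradient V (x j), u⟫) =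
      ∏ j, ENNReal.ofReal (Real.exp ⟪gradient V (x j), u⟫) := fun x => by
    rw [sum_inner, Real.exp_sum, ENNReal.ofReal_prod_of_nonneg fun _ _ => (Real.exp_pos _).le]
  simp_rw [hprod]
  rw [ProbabilityTheory.lintegral_prod_eq_prod_lintegral_of_indepFun Finset.univ
    (fun j (x : Fin n → Euc d) => ENNReal.ofReal (Real.exp ⟪gradient V (x j), u⟫))
    (ProbabilityTheory.iIndepFun_pi fun _ => hf.aemeasurable)
    (fun j => hf.comp (measurable_pi_apply j))]
  calc _ ≤ ∏ _j : Fin n, ENNReal.ofReal (Real.exp (M * ‖u‖ ^ 2)) := by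
        refine Finset.prod_le_prod' fun j _ => ?_
        rw [(measurePreserving_eval (fun _ : Fin n => noiseMeasure V) j).lintegral_comp hf]
        exact lintegral_exp_inner_gradient_le hV hint hM u
    _ = _ := by
        rw [Finset.prod_const, Finset.card_univ, Fintype.card_fin,
          ← ENNReal.ofReal_pow (Real.exp_pos _).le, ← Real.exp_nat_mul, mul_assoc]

lemma lintegral_exp_neg_mul_sq_norm {d : ℕ} {b : ℝ} (hb : 0 < b) :
    ∫⁻ u : Euc d, ENNReal.ofReal (Real.exp (-b * ‖u‖ ^ 2)) =
      ENNReal.ofReal ((π / b) ^ (d / 2 : ℝ)) := by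
  have h := GaussianFourier.integral_rexp_neg_mul_sq_norm (V := Euc d) hb
  rw [finrank_euclideanSpace_fin] at h
  have hi : Integrable (fun u : Euc d => Real.exp (-b * ‖u‖ ^ 2)) := by
    by_contra hc
    rw [integral_undef hc] at h
    exact (Real.rpow_pos_of_pos (div_pos pi_pos hb) _).ne h
  rw [← ofReal_integral_eq_lintegral_ofReal hi (ae_of_all _ fun x => (Real.exp_pos _).le), h]

lemma lintegral_exp_inner_sub_mul_sq_norm {d : ℕ} {b : ℝ} (hb : 0 < b) (s : Euc d) :
    ∫⁻ u : Euc d, ENNReal.ofReal (Real.exp (⟪s, u⟫ - b * ‖u‖ ^ 2)) =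
      ENNReal.ofReal (Real.exp (‖s‖ ^ 2 / (4 * b))) * ENNReal.ofReal ((π / b) ^ (d / 2 : ℝ)) := by
  rw [← lintegral_exp_neg_mul_sq_norm hb,
    ← lintegral_add_right_eq_self _ ((1 / (2 * b)) • s), ← lintegral_const_mul _ (by fun_prop)]
  refine lintegral_congr fun u => ?_
  rw [← ENNReal.ofReal_mul (Real.exp_pos _).le, ← Real.exp_add, norm_add_sq_real,
    inner_add_right, real_inner_smul_right, real_inner_smul_right, norm_smul, mul_pow,
    Real.norm_eq_abs, sq_abs, real_inner_comm s u, real_inner_self_eq_norm_sq]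
  congr 2
  field_simp
  ring

/-- Exponential square moment of a random vector with sub-Gaussian marginals, by averaging the
moment generating function against a Gaussian. -/
lemma lintegral_exp_sq_norm_le {Ω : Type*} [MeasurableSpace Ω] {P : Measure Ω} [SFinite P]
    {d : ℕ} {S : Ω → Euc d} (hS : Measurable S) {a : ℝ} (ha : 0 < a)
    (hmgf : ∀ u, ∫⁻ ω, ENNReal.ofReal (Real.exp ⟪S ω, u⟫) ∂P ≤
      ENNReal.ofReal (Real.exp (a * ‖u‖ ^ 2))) :
    ∫⁻ ω, ENNReal.ofReal (Real.exp (‖S ω‖ ^ 2 / (8 * a))) ∂P ≤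
      ENNReal.ofReal (2 ^ (d / 2 : ℝ)) := by
  have h2a : 0 < 2 * a := by positivity
  have hpos : 0 < (π / (2 * a)) ^ (d / 2 : ℝ) := Real.rpow_pos_of_pos (div_pos pi_pos h2a) _
  have hle : (∫⁻ ω, ENNReal.ofReal (Real.exp (‖S ω‖ ^ 2 / (8 * a))) ∂P) *
      ENNReal.ofReal ((π / (2 * a)) ^ (d / 2 : ℝ)) ≤
      ENNReal.ofReal (2 ^ (d / 2 : ℝ)) * ENNReal.ofReal ((π / (2 * a)) ^ (d / 2 : ℝ)) := by
    calc _ = ∫⁻ ω, ∫⁻ u : Euc d,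
          ENNReal.ofReal (Real.exp (⟪S ω, u⟫ - 2 * a * ‖u‖ ^ 2)) ∂volume ∂P := by
          rw [← lintegral_mul_const _ (by fun_prop)]
          refine lintegral_congr fun ω => ?_
          rw [lintegral_exp_inner_sub_mul_sq_norm h2a]
          congr 4
          ring
      _ = ∫⁻ u : Euc d, ∫⁻ ω,
          ENNReal.ofReal (Real.exp (⟪S ω, u⟫ - 2 * a * ‖u‖ ^ 2)) ∂P :=
          lintegral_lintegral_swap (by unfold Function.uncurry; fun_prop)
      _ ≤ ∫⁻ u : Euc d, ENNReal.ofReal (Real.exp (-a * ‖u‖ ^ 2)) := by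
          refine lintegral_mono fun u => ?_
          have hsplit : ∀ ω, ENNReal.ofReal (Real.exp (⟪S ω, u⟫ - 2 * a * ‖u‖ ^ 2)) =
              ENNReal.ofReal (Real.exp ⟪S ω, u⟫) *
                ENNReal.ofReal (Real.exp (-(2 * a * ‖u‖ ^ 2))) := fun ω => by
            rw [← ENNReal.ofReal_mul (Real.exp_pos _).le, ← Real.exp_add, sub_eq_add_neg]
          simp_rw [hsplit]
          rw [lintegral_mul_const _ (by fun_prop)]
          refine (mul_le_mul_left (hmgf u) _).trans_eq ?_
          rw [← ENNReal.ofReal_mul (Real.exp_pos _).le, ← Real.exp_add]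
          congr 2
          ring
      _ = _ := by
          rw [lintegral_exp_neg_mul_sq_norm ha, ← ENNReal.ofReal_mul (by positivity),
            ← Real.mul_rpow (by positivity) (by positivity)]
          congr 2
          field_simp
  exact (ENNReal.mul_le_mul_iff_left (ENNReal.ofReal_pos.mpr hpos).ne' ENNReal.ofReal_ne_top).mp hle

/-- Tail bound for a random vector with sub-Gaussian marginals. -/
lemma measure_lt_sq_norm_le {Ω : Type*} [MeasurableSpace Ω] {P : Measure Ω} [SFinite P]
    {d : ℕ} {S : Ω → Euc d} (hS : Measurable S) {a : ℝ} (ha : 0 < a)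
    (hmgf : ∀ u, ∫⁻ ω, ENNReal.ofReal (Real.exp ⟪S ω, u⟫) ∂P ≤
      ENNReal.ofReal (Real.exp (a * ‖u‖ ^ 2))) (t : ℝ) :
    P {ω | 8 * a * (d + t) < ‖S ω‖ ^ 2} ≤ ENNReal.ofReal (Real.exp (-t)) := by
  have hexp : (2 : ℝ) ^ (d / 2 : ℝ) ≤ Real.exp d := by
    rw [Real.rpow_def_of_pos two_pos]
    refine Real.exp_le_exp.mpr ?_
    nlinarith [Real.log_two_lt_d9, (Nat.cast_nonneg d : (0 : ℝ) ≤ d)]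
  have hmarkov := mul_meas_ge_le_lintegral₀ (μ := P)
    (f := fun ω => ENNReal.ofReal (Real.exp (‖S ω‖ ^ 2 / (8 * a)))) (by fun_prop)
    (ENNReal.ofReal (Real.exp (d + t)))
  have hsub : P {ω | 8 * a * (d + t) < ‖S ω‖ ^ 2} ≤ P {ω | ENNReal.ofReal (Real.exp (d + t)) ≤
      ENNReal.ofReal (Real.exp (‖S ω‖ ^ 2 / (8 * a)))} := by
    refine measure_mono fun ω hω => ?_
    refine ENNReal.ofReal_le_ofReal (Real.exp_le_exp.mpr ?_)
    rw [le_div_iff₀ (by positivity), mul_comm]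
    exact hω.le
  have hprod : ENNReal.ofReal (Real.exp (d + t)) * ENNReal.ofReal (Real.exp (-t)) =
      ENNReal.ofReal (Real.exp d) := by
    rw [← ENNReal.ofReal_mul (Real.exp_pos _).le, ← Real.exp_add, add_neg_cancel_right]
  refine hsub.trans ((ENNReal.mul_le_mul_iff_right
    (ENNReal.ofReal_pos.mpr (Real.exp_pos (d + t))).ne' ENNReal.ofReal_ne_top).mp ?_)
  rw [hprod]
  exact hmarkov.trans ((lintegral_exp_sq_norm_le hS ha hmgf).trans (ENNReal.ofReal_le_ofReal hexp))

/-- Corollary 3.4 / `cor_g_n'`: high-probability bound on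
`‖g_n'(0)‖ = ‖n^{-1} Σ_j V'(ξ_j)‖`. -/
theorem stmt_11 :
    ∃ C : ℝ, 0 < C ∧
      ∀ (L M m : ℝ),
        0 < L → 0 < M → 0 < m →
        ∀ (d n : ℕ) (V : Euc d → ℝ) (J : Euc d →L[ℝ] Euc d),
          0 < n →
          StrictConvexOn ℝ Set.univ V →
          ContDiff ℝ 2 V →
          (∫ x, Real.exp (-(V x)) = 1) →
          (∀ x, ‖iteratedFDeriv ℝ 2 V x‖ ≤ M) →
          (∀ x y, ‖iteratedFDeriv ℝ 2 V x - iteratedFDeriv ℝ 2 V y‖ ≤ L * ‖x - y‖) →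
          (∀ u, J u = ∫ x, ⟪gradient V x, u⟫ • gradient V x ∂ noiseMeasure V) →
          (∀ u : Euc d, m * ‖u‖ ^ 2 ≤ ⟪J u, u⟫) →
          ∀ t : ℝ, 1 ≤ t →
            ENNReal.ofReal (1 - Real.exp (-t)) ≤
              (Measure.pi fun _ : Fin n => noiseMeasure V)
                {x | ‖(n : ℝ)⁻¹ • ∑ j, gradient V (x j)‖ ≤
                  C * Real.sqrt M *
                    max (Real.sqrt ((d : ℝ) / n)) (Real.sqrt (t / n))} := by
  refine ⟨4, by norm_num, ?_⟩
  intro L M m _ hM _ d n V J hn _ hV hint hbd _ _ _ t ht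
  have := isProbabilityMeasure_noiseMeasure hint
  have hg := (continuous_gradient_of_contDiff hV).measurable
  have hn' : (0 : ℝ) < n := Nat.cast_pos.mpr hn
  set P := Measure.pi fun _ : Fin n => noiseMeasure V
  set A := {x : Fin n → Euc d | ‖(n : ℝ)⁻¹ • ∑ j, gradient V (x j)‖ ≤
    4 * Real.sqrt M * max (Real.sqrt ((d : ℝ) / n)) (Real.sqrt (t / n))}
  have hA : MeasurableSet A := measurableSet_le (by fun_prop) measurable_const
  have htail := measure_lt_sq_norm_le (P := P) (S := fun x => ∑ j, gradient V (x j))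
    (by fun_prop) (mul_pos hn' hM) (lintegral_exp_inner_sum_gradient_le hV hint hbd) t
  have hsub : Aᶜ ⊆ {x | 8 * (n * M) * (d + t) < ‖∑ j, gradient V (x j)‖ ^ 2} := by
    intro x hx
    have hx' : 4 * Real.sqrt M * max (Real.sqrt ((d : ℝ) / n)) (Real.sqrt (t / n)) <
        ‖(n : ℝ)⁻¹ • ∑ j, gradient V (x j)‖ := not_le.mp hx
    rw [norm_smul, Real.norm_of_nonneg (by positivity)] at hx'
    have hsq := pow_lt_pow_left₀ hx' (by positivity) two_ne_zero
    have hbound : ∀ y z : ℝ, 0 ≤ y → Real.sqrt (y / n) ≤ z → y ≤ n * z ^ 2 := fun y z hy hz => by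
      have h := (Real.sqrt_le_iff.mp hz).2
      rwa [div_le_iff₀' hn'] at h
    have hd := hbound d _ (by positivity) (le_max_left (Real.sqrt ((d : ℝ) / n)) (Real.sqrt (t / n)))
    have ht := hbound t _ (by linarith)
      (le_max_right (Real.sqrt ((d : ℝ) / n)) (Real.sqrt (t / n)))
    rw [mul_pow, mul_pow, Real.sq_sqrt hM.le, mul_pow, inv_pow, inv_mul_eq_div,
      lt_div_iff₀ (by positivity)] at hsq
    refine lt_of_le_of_lt ?_ hsq
    nlinarith [mul_le_mul_of_nonneg_left (add_le_add hd ht) (mul_pos hn' hM).le]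
  have hc : P Aᶜ ≤ ENNReal.ofReal (Real.exp (-t)) := (measure_mono hsub).trans htail
  rw [ENNReal.ofReal_sub _ (Real.exp_pos _).le, ENNReal.ofReal_one, tsub_le_iff_right,
    ← prob_add_prob_compl (μ := P) hA]
  gcongr
end
end
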